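/- For every m-dimensional totally isotropic subspace W of (V, g), the annihilator Ann(W) := {ξ ∈ S : ρ(x)(ξ) = 0 for all x ∈ W} is a one-dimensional subspace of S, and every nonzero element ξ of Ann(W) is pure with K_ξ = W. Conversely, for every pure spinor ξ the kernel K_ξ is an m-dimensional totally isotropic subspace with Ann(K_ξ) = span{ξ}. Hence W ↦ Ann(W) is a bijection between the set of m-dimensional totally isotropic subspaces of (V, g) (γ-planes) and the set of lines in S spanned by pure spinors. -/

import Mathlib

noncomputable section

open scoped TensorProduct

/-- The `(2m+1)`-dimensional space `V := N × N* × ℂ`. -/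
abbrev Vsp (N : Type) [AddCommGroup N] [Module ℂ N] : Type := N × (N →ₗ[ℂ] ℂ) × ℂ

/-- The bilinear map `B((v,φ,t),(v',φ',t')) = φ(v') − t·t'`, whose diagonal is `Q`. -/
def Bform (N : Type) [AddCommGroup N] [Module ℂ N] : Vsp N →ₗ[ℂ] Vsp N →ₗ[ℂ] ℂ :=
  LinearMap.mk₂ ℂ (fun x y => x.2.1 y.1 - x.2.2 * y.2.2)
    (fun x x' y => by simp only [Prod.fst_add, Prod.snd_add, LinearMap.add_apply]; ring)
    (fun c x y => by
      simp only [Prod.smul_fst, Prod.smul_snd, LinearMap.smul_apply, smul_eq_mul]; ring)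
    (fun x y y' => by simp only [Prod.fst_add, Prod.snd_add, map_add]; ring)
    (fun c x y => by simp only [Prod.smul_fst, Prod.smul_snd, map_smul, smul_eq_mul]; ring)

/-- The quadratic form `Q(v, φ, t) := φ(v) − t²`. -/
def Qform (N : Type) [AddCommGroup N] [Module ℂ N] : QuadraticForm ℂ (Vsp N) :=
  LinearMap.BilinMap.toQuadraticMap (Bform N)

/-- The polar form `g(x,y) := (Q(x+y) − Q(x) − Q(y))/2`. -/
def gform (N : Type) [AddCommGroup N] [Module ℂ N] (x y : Vsp N) : ℂ :=
  (Qform N (x + y) - Qform N x - Qform N y) / 2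

/-- `σ` : the involution acting on `⋀^k N` as `(−1)^(m−k)`. -/
def sigmaMap (m : ℕ) (N : Type) [AddCommGroup N] [Module ℂ N] :
    ExteriorAlgebra ℂ N →ₗ[ℂ] ExteriorAlgebra ℂ N :=
  ((-1 : ℂ) ^ m) • (CliffordAlgebra.involute (Q := (0 : QuadraticForm ℂ N))).toLinearMap

/-- `ρ(v, φ, t)(ξ) := v ∧ ξ − ι_φ(ξ) + t·σ(ξ)`. -/
def rho (m : ℕ) (N : Type) [AddCommGroup N] [Module ℂ N] :
    Vsp N →ₗ[ℂ] ExteriorAlgebra ℂ N →ₗ[ℂ] ExteriorAlgebra ℂ N :=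
  (LinearMap.mul ℂ (ExteriorAlgebra ℂ N) ∘ₗ ExteriorAlgebra.ι ℂ ∘ₗ
      LinearMap.fst ℂ N ((N →ₗ[ℂ] ℂ) × ℂ))
  - (CliffordAlgebra.contractLeft (Q := (0 : QuadraticForm ℂ N)) ∘ₗ
      LinearMap.fst ℂ (N →ₗ[ℂ] ℂ) ℂ ∘ₗ LinearMap.snd ℂ N ((N →ₗ[ℂ] ℂ) × ℂ))
  + (LinearMap.toSpanSingleton ℂ (ExteriorAlgebra ℂ N →ₗ[ℂ] ExteriorAlgebra ℂ N)
        (sigmaMap m N) ∘ₗ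
      LinearMap.snd ℂ (N →ₗ[ℂ] ℂ) ℂ ∘ₗ LinearMap.snd ℂ N ((N →ₗ[ℂ] ℂ) × ℂ))

/-- `K_ξ := {x ∈ V : ρ(x)(ξ) = 0}`. -/
def Kker (m : ℕ) (N : Type) [AddCommGroup N] [Module ℂ N] (ξ : ExteriorAlgebra ℂ N) :
    Submodule ℂ (Vsp N) :=
  LinearMap.ker ((rho m N).flip ξ)

/-- The annihilator `Ann(W) := {ξ ∈ S : ρ(x)(ξ) = 0 for all x ∈ W}`. -/
def AnnW (m : ℕ) (N : Type) [AddCommGroup N] [Module ℂ N] (W : Submodule ℂ (Vsp N)) :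
    Submodule ℂ (ExteriorAlgebra ℂ N) :=
  ⨅ x ∈ W, LinearMap.ker (rho m N x)

section RestrictedAnticommutator

variable {K E : Type*} [Field K] [AddCommGroup E] [Module K E] [FiniteDimensional K E]

/-- If `a` and `b` preserve `T`, `a² = 0` on `T` and `ab + ba` is a nonzero scalar on `T`, then the
kernel of `a` in `T` has half the dimension of `T`. -/
theorem Submodule.finrank_inf_ker_mul_two {T : Submodule K E} {a b : E →ₗ[K] E} {c : K}
    (hc : c ≠ 0) (ha : ∀ x ∈ T, a x ∈ T) (hb : ∀ x ∈ T, b x ∈ T) (haa : ∀ x ∈ T, a (a x) = 0)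
    (hab : ∀ x ∈ T, a (b x) + b (a x) = c • x) :
    Module.finrank K ↥(T ⊓ LinearMap.ker a) * 2 = Module.finrank K T := by
  have hker : T ⊓ LinearMap.ker a = (LinearMap.ker (a.restrict ha)).map T.subtype := by
    ext x
    simp only [Submodule.mem_inf, LinearMap.mem_ker, Submodule.mem_map, Submodule.subtype_apply,
      Subtype.exists, exists_and_right, exists_eq_right, Subtype.ext_iff,
      LinearMap.coe_restrict_apply, ZeroMemClass.coe_zero, exists_prop]
  have hrange : LinearMap.range (a.restrict ha) = LinearMap.ker (a.restrict ha) := by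
    apply le_antisymm
    · rintro _ ⟨x, rfl⟩
      exact Subtype.ext (haa x x.2)
    · intro x hx
      have hax : a x = 0 := congrArg Subtype.val hx
      refine ⟨c⁻¹ • ⟨b x, hb x x.2⟩, Subtype.ext ?_⟩
      have h := hab x x.2
      rw [hax, map_zero, add_zero] at h
      simp [h, hc]
  have hdim := LinearMap.finrank_range_add_finrank_ker (a.restrict ha)
  rw [hker, Submodule.finrank_map_subtype_eq]
  rw [hrange] at hdim
  omega

end RestrictedAnticommutator

theorem CliffordAlgebra.involute_contractLeft {R M : Type*} [CommRing R] [AddCommGroup M]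
    [Module R M] {Q : QuadraticForm R M} (d : Module.Dual R M) (x : CliffordAlgebra Q) :
    involute (contractLeft d x) = -contractLeft d (involute x) := by
  induction x using CliffordAlgebra.left_induction with
  | algebraMap r => simp
  | add x y hx hy => simp only [map_add, hx, hy, neg_add]
  | ι_mul x v hx =>
    simp only [contractLeft_ι_mul, map_sub, map_smul, map_mul, involute_ι, hx, neg_mul, map_neg]
    simp

theorem ExteriorAlgebra.finiteDimensional (K N : Type*) [Field K] [AddCommGroup N] [Module K N]
    [FiniteDimensional K N] : FiniteDimensional K (ExteriorAlgebra K N) :=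
  .of_basis (Module.finBasis K N).ExteriorAlgebra

theorem ExteriorAlgebra.finrank_eq (K N : Type*) [Field K] [AddCommGroup N] [Module K N]
    [FiniteDimensional K N] :
    Module.finrank K (ExteriorAlgebra K N) = 2 ^ Module.finrank K N := by
  simp [Module.finrank_eq_card_basis (Module.finBasis K N).ExteriorAlgebra]

section Spinors

variable {m : ℕ} {N : Type} [AddCommGroup N] [Module ℂ N]

theorem gform_apply (x y : Vsp N) :
    gform N x y = (x.2.1 y.1 + y.2.1 x.1) / 2 - x.2.2 * y.2.2 := by
  simp only [gform, Qform, Bform, LinearMap.BilinMap.toQuadraticMap_apply, LinearMap.mk₂_apply,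
    LinearMap.add_apply, map_add]
  ring

theorem rho_apply (x : Vsp N) (ξ : ExteriorAlgebra ℂ N) :
    rho m N x ξ = ExteriorAlgebra.ι ℂ x.1 * ξ
      - CliffordAlgebra.contractLeft (Q := (0 : QuadraticForm ℂ N)) x.2.1 ξ
      + (x.2.2 * (-1) ^ m) • CliffordAlgebra.involute (Q := (0 : QuadraticForm ℂ N)) ξ := by
  simp [rho, sigmaMap, mul_smul]

/-- The Clifford relation. -/
theorem rho_rho_add_rho_rho (x y : Vsp N) (ξ : ExteriorAlgebra ℂ N) :
    rho m N x (rho m N y ξ) + rho m N y (rho m N x ξ) = (-2 * gform N x y) • ξ := by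
  have hιι : ExteriorAlgebra.ι ℂ x.1 * (ExteriorAlgebra.ι ℂ y.1 * ξ) =
      -(ExteriorAlgebra.ι ℂ y.1 * (ExteriorAlgebra.ι ℂ x.1 * ξ)) := by
    rw [← mul_assoc, ← mul_assoc, ← neg_mul,
      eq_neg_of_add_eq_zero_left (ExteriorAlgebra.ι_add_mul_swap x.1 y.1)]
  have hcontract (d : N →ₗ[ℂ] ℂ) (v : N) (η : ExteriorAlgebra ℂ N) :
      CliffordAlgebra.contractLeft (Q := (0 : QuadraticForm ℂ N)) d (ExteriorAlgebra.ι ℂ v * η) =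
        d v • η - ExteriorAlgebra.ι ℂ v *
          CliffordAlgebra.contractLeft (Q := (0 : QuadraticForm ℂ N)) d η :=
    CliffordAlgebra.contractLeft_ι_mul d v η
  have hinvol (v : N) : CliffordAlgebra.involute (Q := (0 : QuadraticForm ℂ N))
      (ExteriorAlgebra.ι ℂ v) = -ExteriorAlgebra.ι ℂ v := CliffordAlgebra.involute_ι v
  simp only [rho_apply, map_add, map_sub, map_smul, map_mul, mul_sub, hιι, hcontract,
    hinvol, CliffordAlgebra.involute_contractLeft, CliffordAlgebra.involute_involute, neg_mul,
    CliffordAlgebra.contractLeft_comm x.2.1 y.2.1 ξ, gform_apply]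
  rcases neg_one_pow_eq_or ℂ m with h | h <;> rw [h] <;> module

/-- Every linear functional on `V` is represented by `g`. -/
theorem exists_gform_eq [FiniteDimensional ℂ N] (f : Vsp N →ₗ[ℂ] ℂ) :
    ∃ u : Vsp N, ∀ x, gform N x u = f x := by
  obtain ⟨n, hn⟩ := (Module.evalEquiv ℂ N).surjective
    (f ∘ₗ LinearMap.inr ℂ N _ ∘ₗ LinearMap.inl ℂ (N →ₗ[ℂ] ℂ) ℂ)
  refine ⟨((2 : ℂ) • n, (2 : ℂ) • (f ∘ₗ LinearMap.inl ℂ N _), -f (0, 0, 1)), fun x => ?_⟩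
  have hφ : x.2.1 n = f (0, x.2.1, 0) := LinearMap.congr_fun hn x.2.1
  have ht : f (0, 0, x.2.2) = x.2.2 * f (0, 0, 1) := by
    rw [← smul_eq_mul, ← map_smul]
    simp
  have hx : x = (x.1, 0, 0) + (0, x.2.1, 0) + (0, 0, x.2.2) := by simp
  conv_rhs => rw [hx, map_add, map_add, ht, ← hφ]
  simp only [gform_apply, map_smul, LinearMap.smul_apply, LinearMap.comp_apply,
    LinearMap.inl_apply, smul_eq_mul, Prod.mk_zero_zero]
  ring

theorem mem_AnnW {W : Submodule ℂ (Vsp N)} {ξ : ExteriorAlgebra ℂ N} :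
    ξ ∈ AnnW m N W ↔ ∀ x ∈ W, rho m N x ξ = 0 := by
  simp [AnnW]

theorem mem_Kker {x : Vsp N} {ξ : ExteriorAlgebra ℂ N} :
    x ∈ Kker m N ξ ↔ rho m N x ξ = 0 := by
  simp [Kker]

theorem AnnW_span_insert (x : Vsp N) (s : Set (Vsp N)) :
    AnnW m N (Submodule.span ℂ (insert x s)) =
      AnnW m N (Submodule.span ℂ s) ⊓ LinearMap.ker (rho m N x) := by
  ext ξ
  have key (t : Set (Vsp N)) : ξ ∈ AnnW m N (Submodule.span ℂ t) ↔ ∀ y ∈ t, y ∈ Kker m N ξ := by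
    simp only [mem_AnnW, ← mem_Kker]
    exact Submodule.span_le
  simp only [Submodule.mem_inf, key, Set.forall_mem_insert, mem_Kker, LinearMap.mem_ker, and_comm]

theorem finrank_AnnW_span_range [FiniteDimensional ℂ N] {k : ℕ} (w : Fin k → Vsp N)
    (hw : LinearIndependent ℂ w) (hiso : ∀ i j, gform N (w i) (w j) = 0) :
    Module.finrank ℂ (AnnW m N (Submodule.span ℂ (Set.range w))) * 2 ^ k =
      2 ^ Module.finrank ℂ N := by
  have := ExteriorAlgebra.finiteDimensional ℂ N
  induction k with
  | zero =>
    have htop : AnnW m N (Submodule.span ℂ (Set.range w)) = ⊤ := by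
      simp [Submodule.eq_top_iff', mem_AnnW, Set.range_eq_empty]
    rw [htop, finrank_top, ExteriorAlgebra.finrank_eq, pow_zero, mul_one]
  | succ k ih =>
    obtain ⟨htail, hnot⟩ := linearIndependent_finSucc.1 hw
    have hrange : Set.range w = insert (w 0) (Set.range (Fin.tail w)) := by
      rw [← Fin.range_cons, Fin.cons_self_tail]
    obtain ⟨f, hf, hker⟩ := Submodule.exists_le_ker_of_notMem hnot
    obtain ⟨u, hu⟩ := exists_gform_eq f
    have hspan (y : Vsp N) (h0 : ∀ i, gform N (Fin.tail w i) y = 0)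
        (ξ : ExteriorAlgebra ℂ N) (hξ : ξ ∈ AnnW m N (Submodule.span ℂ (Set.range (Fin.tail w)))) :
        rho m N y ξ ∈ AnnW m N (Submodule.span ℂ (Set.range (Fin.tail w))) := by
      simp only [mem_AnnW, ← mem_Kker] at hξ ⊢
      refine Submodule.span_le.2 ?_
      rintro _ ⟨i, rfl⟩
      have hz := mem_Kker.1 (hξ _ (Submodule.subset_span ⟨i, rfl⟩))
      have h := rho_rho_add_rho_rho (m := m) (Fin.tail w i) y ξ
      rw [hz, h0, map_zero, add_zero, mul_zero, zero_smul] at h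
      exact mem_Kker.2 h
    have hstep := Submodule.finrank_inf_ker_mul_two
      (T := AnnW m N (Submodule.span ℂ (Set.range (Fin.tail w))))
      (a := rho m N (w 0)) (b := rho m N u) (c := -2 * gform N (w 0) u)
      (by rw [hu]; exact mul_ne_zero (by norm_num) hf)
      (hspan _ fun i => hiso _ _)
      (hspan _ fun i => by rw [hu]; exact hker (Submodule.subset_span ⟨i, rfl⟩))
      (fun ξ _ => by
        have h := rho_rho_add_rho_rho (m := m) (w 0) (w 0) ξ
        rw [hiso, mul_zero, zero_smul, ← two_smul ℂ] at h
        exact (smul_eq_zero.1 h).resolve_left two_ne_zero)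
      (fun ξ _ => rho_rho_add_rho_rho _ _ _)
    rw [hrange, AnnW_span_insert, ← ih _ htail fun i j => hiso _ _, ← hstep]
    ring

theorem finrank_AnnW [FiniteDimensional ℂ N] (W : Submodule ℂ (Vsp N))
    (hiso : ∀ x ∈ W, ∀ y ∈ W, gform N x y = 0) :
    Module.finrank ℂ (AnnW m N W) * 2 ^ Module.finrank ℂ W = 2 ^ Module.finrank ℂ N := by
  let b := Module.finBasis ℂ W
  have hspan : Submodule.span ℂ (Set.range (W.subtype ∘ b)) = W := by
    rw [Set.range_comp, Submodule.span_image, b.span_eq, Submodule.map_top, Submodule.range_subtype]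
  have h := finrank_AnnW_span_range (m := m) (W.subtype ∘ b)
    (b.linearIndependent.map' _ W.ker_subtype) fun i j => hiso _ (b i).2 _ (b j).2
  rwa [hspan] at h

theorem isotropic_Kker {ξ : ExteriorAlgebra ℂ N} (hξ : ξ ≠ 0) :
    ∀ x ∈ Kker m N ξ, ∀ y ∈ Kker m N ξ, gform N x y = 0 := by
  intro x hx y hy
  have h := rho_rho_add_rho_rho (m := m) x y ξ
  rw [mem_Kker.1 hx, mem_Kker.1 hy, map_zero, map_zero, add_zero] at h
  simpa [hξ] using h.symm

theorem mem_AnnW_Kker (ξ : ExteriorAlgebra ℂ N) : ξ ∈ AnnW m N (Kker m N ξ) :=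
  mem_AnnW.2 fun _ hx => mem_Kker.1 hx

theorem finrank_Kker_le [FiniteDimensional ℂ N] {ξ : ExteriorAlgebra ℂ N} (hξ : ξ ≠ 0) :
    Module.finrank ℂ (Kker m N ξ) ≤ Module.finrank ℂ N :=
  (Nat.pow_dvd_pow_iff_le_right (Nat.lt_succ_self 1)).1
    (Dvd.intro_left _ (finrank_AnnW (m := m) (Kker m N ξ) (isotropic_Kker hξ)))

theorem finrank_AnnW_eq_one [FiniteDimensional ℂ N] {W : Submodule ℂ (Vsp N)}
    (hiso : ∀ x ∈ W, ∀ y ∈ W, gform N x y = 0)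
    (hW : Module.finrank ℂ W = Module.finrank ℂ N) : Module.finrank ℂ (AnnW m N W) = 1 := by
  have h := finrank_AnnW (m := m) W hiso
  rw [hW] at h
  exact Nat.eq_of_mul_eq_mul_right (by positivity) (h.trans (one_mul _).symm)

theorem Kker_eq_of_mem_AnnW [FiniteDimensional ℂ N] {W : Submodule ℂ (Vsp N)}
    (hW : Module.finrank ℂ W = Module.finrank ℂ N) {ξ : ExteriorAlgebra ℂ N}
    (hξ : ξ ∈ AnnW m N W) (h0 : ξ ≠ 0) : Kker m N ξ = W :=
  (Submodule.eq_of_le_of_finrank_le (fun x hx => mem_Kker.2 (mem_AnnW.1 hξ x hx))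
    (hW ▸ finrank_Kker_le h0)).symm

theorem AnnW_eq_span_singleton [FiniteDimensional ℂ N] {W : Submodule ℂ (Vsp N)}
    (hiso : ∀ x ∈ W, ∀ y ∈ W, gform N x y = 0)
    (hW : Module.finrank ℂ W = Module.finrank ℂ N) {ξ : ExteriorAlgebra ℂ N}
    (hξ : ξ ∈ AnnW m N W) (h0 : ξ ≠ 0) : AnnW m N W = Submodule.span ℂ {ξ} := by
  have := ExteriorAlgebra.finiteDimensional ℂ N
  refine (Submodule.eq_of_le_of_finrank_eq ?_ ?_).symm
  · rwa [Submodule.span_singleton_le_iff_mem]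
  · rw [finrank_span_singleton h0, finrank_AnnW_eq_one hiso hW]

theorem exists_mem_AnnW_ne_zero [FiniteDimensional ℂ N] {W : Submodule ℂ (Vsp N)}
    (hiso : ∀ x ∈ W, ∀ y ∈ W, gform N x y = 0)
    (hW : Module.finrank ℂ W = Module.finrank ℂ N) : ∃ ξ ∈ AnnW m N W, ξ ≠ 0 :=
  Submodule.exists_mem_ne_zero_of_ne_bot fun h => by
    have h1 := finrank_AnnW_eq_one (m := m) hiso hW
    rw [h, finrank_bot] at h1
    exact zero_ne_one h1

end Spinors

/-- `W ↦ Ann(W)` is a bijection between `m`-dimensional totally isotropic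
subspaces (γ-planes) of `(V,g)` and lines spanned by pure spinors. -/
theorem gamma_planes_biject_pure_spinor_lines
    (m : ℕ) (hm : 0 < m) (N : Type) [AddCommGroup N] [Module ℂ N]
    [FiniteDimensional ℂ N] (hdim : Module.finrank ℂ N = m) :
    (∀ W : Submodule ℂ (Vsp N), (∀ x ∈ W, ∀ y ∈ W, gform N x y = 0) →
      Module.finrank ℂ W = m →
      Module.finrank ℂ (AnnW m N W) = 1 ∧
        ∀ ξ ∈ AnnW m N W, ξ ≠ 0 →
          Module.finrank ℂ (Kker m N ξ) = m ∧ Kker m N ξ = W) ∧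
    (∀ ξ : ExteriorAlgebra ℂ N, ξ ≠ 0 → Module.finrank ℂ (Kker m N ξ) = m →
      (∀ x ∈ Kker m N ξ, ∀ y ∈ Kker m N ξ, gform N x y = 0) ∧
        AnnW m N (Kker m N ξ) = Submodule.span ℂ {ξ}) ∧
    Set.BijOn (AnnW m N)
      {W : Submodule ℂ (Vsp N) | (∀ x ∈ W, ∀ y ∈ W, gform N x y = 0) ∧
        Module.finrank ℂ W = m}
      {L : Submodule ℂ (ExteriorAlgebra ℂ N) | ∃ ξ : ExteriorAlgebra ℂ N,
        (ξ ≠ 0 ∧ Module.finrank ℂ (Kker m N ξ) = m) ∧ L = Submodule.span ℂ {ξ}} := by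
  subst hdim
  refine ⟨fun W hiso hW => ⟨finrank_AnnW_eq_one hiso hW, fun ξ hξ h0 => ?_⟩,
    fun ξ h0 hξ => ⟨isotropic_Kker h0,
      AnnW_eq_span_singleton (isotropic_Kker h0) hξ (mem_AnnW_Kker ξ) h0⟩, ?_, ?_, ?_⟩
  · have hK := Kker_eq_of_mem_AnnW hW hξ h0
    exact ⟨hK ▸ hW, hK⟩
  · rintro W ⟨hiso, hW⟩
    obtain ⟨ξ, hξ, h0⟩ := exists_mem_AnnW_ne_zero (m := Module.finrank ℂ N) hiso hW
    exact ⟨ξ, ⟨h0, Kker_eq_of_mem_AnnW hW hξ h0 ▸ hW⟩, AnnW_eq_span_singleton hiso hW hξ h0⟩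
  · rintro W ⟨hiso, hW⟩ W' ⟨-, hW'⟩ heq
    obtain ⟨ξ, hξ, h0⟩ := exists_mem_AnnW_ne_zero (m := Module.finrank ℂ N) hiso hW
    rw [← Kker_eq_of_mem_AnnW hW hξ h0, ← Kker_eq_of_mem_AnnW hW' (heq ▸ hξ) h0]
  · rintro _ ⟨ξ, ⟨h0, hξ⟩, rfl⟩
    exact ⟨Kker _ N ξ, ⟨isotropic_Kker h0, hξ⟩,
      AnnW_eq_span_singleton (isotropic_Kker h0) hξ (mem_AnnW_Kker ξ) h0⟩
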